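/- arXiv:0808.3862 — 6 statements merged into one kernel-verified Lean document; each statement's English description precedes it below -/
import Mathlib

section
/- An n-qubit state ψ is locally maximally entanglable (LME) if and only if ψ is local-unitary equivalent to a state all of whose computational-basis coefficients are phases; that is, if and only if there exist 2×2 unitary matrices V₁,…,Vₙ and real phases α : (Fin n → Bool) → ℝ such that ψ = (V₁ ⊗ ⋯ ⊗ Vₙ) φ, where φ(i) = 2^{-n/2} · exp(I·α(i)) for every i : Fin n → Bool. -/
open Complex

noncomputable section

/-- Identify a bit with an index into `Fin 2`. -/
def bIdx (b : Bool) : Fin 2 := if b then 1 else 0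

/-- The action of the tensor product `U 0 ⊗ U 1 ⊗ ⋯ ⊗ U (n-1)` of 2×2 matrices on an
`n`-qubit vector `ψ : (Fin n → Bool) → ℂ`, via the identification of `ℂ^{2^n}` with the
`n`-fold tensor power of `ℂ²`. -/
def tensorAction {n : ℕ} (U : Fin n → Matrix (Fin 2) (Fin 2) ℂ)
    (ψ : (Fin n → Bool) → ℂ) : (Fin n → Bool) → ℂ :=
  fun i => ∑ j : Fin n → Bool, (∏ k, U k (bIdx (i k)) (bIdx (j k))) * ψ j

/-- The standard Hermitian inner product on `ℂ^ι`. -/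
def hinner {ι : Type*} [Fintype ι] (ψ φ : ι → ℂ) : ℂ :=
  ∑ i, (starRingEnd ℂ) (ψ i) * φ i

/-- `ψ` is locally maximally entanglable: there are controlled unitaries
`C_l = U_l^{(0)} ⊗ |0⟩⟨0| + U_l^{(1)} ⊗ |1⟩⟨1|` (one per site, each acting on system qubit `l`
and its private ancilla) such that the `2n`-qubit state `(C₁ ⊗ ⋯ ⊗ Cₙ)(ψ ⊗ |+⟩^{⊗n})`,
whose amplitude at (system index `i`, ancilla index `a`) is
`(1/√2)^n ⋅ (U₁^{(a₁)} ⊗ ⋯ ⊗ Uₙ^{(aₙ)} ψ)(i)`, has reduced density matrix on the `n`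
system qubits equal to `2^{-n}` times the identity. -/
def IsLME {n : ℕ} (ψ : (Fin n → Bool) → ℂ) : Prop :=
  ∃ U : Fin n → Bool → Matrix (Fin 2) (Fin 2) ℂ,
    (∀ k b, U k b ∈ Matrix.unitaryGroup (Fin 2) ℂ) ∧
    ∀ i i' : Fin n → Bool,
      (∑ a : Fin n → Bool,
        ((Real.sqrt 2 : ℂ)⁻¹ ^ n * tensorAction (fun k => U k (a k)) ψ i) *
          (starRingEnd ℂ) ((Real.sqrt 2 : ℂ)⁻¹ ^ n * tensorAction (fun k => U k (a k)) ψ i')) =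
      if i = i' then ((2 : ℂ) ^ n)⁻¹ else 0

open Matrix

/-- The matrix of `U 0 ⊗ ⋯ ⊗ U (n-1)` in the computational basis. -/
def tensorMatrix {n : ℕ} (U : Fin n → Matrix (Fin 2) (Fin 2) ℂ) :
    Matrix (Fin n → Bool) (Fin n → Bool) ℂ :=
  Matrix.of fun i j => ∏ k, U k (bIdx (i k)) (bIdx (j k))

theorem tensorAction_eq_mulVec {n : ℕ} (U : Fin n → Matrix (Fin 2) (Fin 2) ℂ)
    (ψ : (Fin n → Bool) → ℂ) : tensorAction U ψ = tensorMatrix U *ᵥ ψ := rfl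

theorem sum_bIdx (f : Fin 2 → ℂ) : ∑ b : Bool, f (bIdx b) = ∑ x, f x := by
  simp [Fin.sum_univ_two, bIdx, add_comm]

theorem bIdx_injective : Function.Injective bIdx := by
  intro a b; cases a <;> cases b <;> simp [bIdx]

theorem sum_prod_bool {n : ℕ} (f : Fin n → Bool → ℂ) :
    ∑ i : Fin n → Bool, ∏ k, f k (i k) = ∏ k, ∑ b, f k b :=
  (Fintype.prod_sum f).symm

theorem tensorMatrix_mul {n : ℕ} (U V : Fin n → Matrix (Fin 2) (Fin 2) ℂ) :
    tensorMatrix U * tensorMatrix V = tensorMatrix fun k => U k * V k := by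
  ext i j
  simp only [Matrix.mul_apply, tensorMatrix, Matrix.of_apply, ← Finset.prod_mul_distrib]
  rw [sum_prod_bool fun k b => U k (bIdx (i k)) (bIdx b) * V k (bIdx b) (bIdx (j k))]
  exact Finset.prod_congr rfl fun k _ =>
    sum_bIdx fun x => U k (bIdx (i k)) x * V k x (bIdx (j k))

theorem tensorMatrix_conjTranspose {n : ℕ} (U : Fin n → Matrix (Fin 2) (Fin 2) ℂ) :
    (tensorMatrix U)ᴴ = tensorMatrix fun k => (U k)ᴴ := by
  ext i j
  simp [tensorMatrix, Matrix.conjTranspose_apply]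

theorem tensorMatrix_diagonal {n : ℕ} (d : Fin n → Fin 2 → ℂ) :
    tensorMatrix (fun k => diagonal (d k)) = diagonal fun i => ∏ k, d k (bIdx (i k)) := by
  ext i j
  by_cases h : i = j
  · subst h; simp [tensorMatrix]
  · obtain ⟨k, hk⟩ := Function.ne_iff.mp h
    rw [diagonal_apply_ne _ h]
    exact Finset.prod_eq_zero (Finset.mem_univ k)
      (diagonal_apply_ne _ fun e => hk (bIdx_injective e))

theorem tensorMatrix_one {n : ℕ} :
    tensorMatrix (fun _ : Fin n => (1 : Matrix (Fin 2) (Fin 2) ℂ)) = 1 := by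
  have := tensorMatrix_diagonal (n := n) fun _ _ => 1
  simpa using this

theorem unitary_mul_conjTranspose {W : Matrix (Fin 2) (Fin 2) ℂ}
    (hW : W ∈ unitaryGroup (Fin 2) ℂ) : W * Wᴴ = 1 :=
  mem_unitaryGroup_iff.mp hW

theorem unitary_conjTranspose_mul {W : Matrix (Fin 2) (Fin 2) ℂ}
    (hW : W ∈ unitaryGroup (Fin 2) ℂ) : Wᴴ * W = 1 :=
  mem_unitaryGroup_iff'.mp hW

/-- Every nonzero vector of `ℂ²` is proportional to the first column of a unitary matrix. -/
theorem exists_unitary_col {v : Fin 2 → ℂ} (hv : v ≠ 0) :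
    ∃ V ∈ unitaryGroup (Fin 2) ℂ, ∃ c : ℂ, ∀ x, V x 0 = c * v x := by
  set s : ℝ := ‖v 0‖ ^ 2 + ‖v 1‖ ^ 2 with hs
  have hpos : 0 < s := by
    by_contra! h
    apply hv
    have h0 : ‖v 0‖ = 0 := by nlinarith [sq_nonneg ‖v 0‖, sq_nonneg ‖v 1‖]
    have h1 : ‖v 1‖ = 0 := by nlinarith [sq_nonneg ‖v 0‖, sq_nonneg ‖v 1‖]
    ext x; fin_cases x
    · simpa using h0
    · simpa using h1
  have hsq : ((Real.sqrt s : ℂ)⁻¹) * (Real.sqrt s : ℂ)⁻¹ * s = 1 := by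
    have h1 : (Real.sqrt s : ℂ) * Real.sqrt s = s := by
      exact_mod_cast Real.mul_self_sqrt hpos.le
    have h2 : (s : ℂ) ≠ 0 := by exact_mod_cast hpos.ne'
    rw [← mul_inv, h1, inv_mul_cancel₀ h2]
  have hsc : (s : ℂ) = v 0 * (starRingEnd ℂ) (v 0) + v 1 * (starRingEnd ℂ) (v 1) := by
    rw [Complex.mul_conj', Complex.mul_conj', hs]; push_cast; rfl
  rw [hsc] at hsq
  set c : ℂ := (Real.sqrt s : ℂ)⁻¹ with hc
  have hcc : (starRingEnd ℂ) c = c := by simp [hc]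
  clear_value c
  refine ⟨!![c * v 0, -(c * (starRingEnd ℂ) (v 1)); c * v 1, c * (starRingEnd ℂ) (v 0)], ?_,
    c, fun x => by fin_cases x <;> simp⟩
  rw [mem_unitaryGroup_iff]
  ext x y
  fin_cases x <;> fin_cases y <;>
    simp [Matrix.mul_apply, Fin.sum_univ_two, star_apply, hcc] <;>
    first | linear_combination hsq | ring

/-- A unitary `2 × 2` matrix is unitarily diagonalizable, with eigenvalues of modulus one. -/
theorem exists_unitary_diagonal {W : Matrix (Fin 2) (Fin 2) ℂ}
    (hW : W ∈ unitaryGroup (Fin 2) ℂ) :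
    ∃ V ∈ unitaryGroup (Fin 2) ℂ, ∃ d : Fin 2 → ℂ,
      W = V * diagonal d * Vᴴ ∧ ∀ x, ‖d x‖ = 1 := by
  obtain ⟨μ, hμ⟩ := Module.End.exists_eigenvalue (Matrix.toLin' W)
  obtain ⟨v, hv⟩ := hμ.exists_hasEigenvector
  have hWv : W *ᵥ v = μ • v := by simpa using hv.apply_eq_smul
  obtain ⟨V, hV, c, hc⟩ := exists_unitary_col hv.2
  have hVV := unitary_mul_conjTranspose hV
  have hVV' := unitary_conjTranspose_mul hV
  set D := Vᴴ * W * V with hD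
  have hDu : D ∈ unitaryGroup (Fin 2) ℂ :=
    mul_mem (mul_mem (Unitary.star_mem hV) hW) hV
  have hWV : ∀ x, (W * V) x 0 = μ * V x 0 := fun x => by
    have h := congrFun hWv x
    simp only [mulVec, dotProduct, Fin.sum_univ_two, Pi.smul_apply, smul_eq_mul] at h
    simp only [mul_apply, Fin.sum_univ_two, hc]
    linear_combination c * h
  have h10 : D 1 0 = 0 := by
    have h := congrFun (congrFun hVV' 1) 0
    rw [hD, Matrix.mul_assoc, mul_apply, Fin.sum_univ_two, hWV, hWV]
    simp only [mul_apply, Fin.sum_univ_two, ne_eq, one_ne_zero, not_false_eq_true,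
      one_apply_ne] at h
    linear_combination μ * h
  have hDD := unitary_mul_conjTranspose hDu
  have hDD' := unitary_conjTranspose_mul hDu
  have h11 : D 1 1 * (starRingEnd ℂ) (D 1 1) = 1 := by
    simpa [mul_apply, Fin.sum_univ_two, h10] using congrFun (congrFun hDD 1) 1
  have h00 : (starRingEnd ℂ) (D 0 0) * D 0 0 = 1 := by
    simpa [mul_apply, Fin.sum_univ_two, h10] using congrFun (congrFun hDD' 0) 0
  have h01 : D 0 1 = 0 := by
    have h : D 0 1 * (starRingEnd ℂ) (D 1 1) = 0 := by
      simpa [mul_apply, Fin.sum_univ_two, h10] using congrFun (congrFun hDD 0) 1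
    exact (mul_eq_zero.mp h).resolve_right (right_ne_zero_of_mul_eq_one h11)
  refine ⟨V, hV, fun x => D x x, ?_, ?_⟩
  · have hd : diagonal (fun x => D x x) = D := by
      ext x y
      fin_cases x <;> fin_cases y <;> simp [h10, h01]
    rw [hd, hD]
    calc W = (V * Vᴴ) * W * (V * Vᴴ) := by simp [hVV]
      _ = _ := by simp only [Matrix.mul_assoc]
  · have key : ∀ z : ℂ, z * (starRingEnd ℂ) z = 1 → ‖z‖ = 1 := fun z hz => by
      rw [Complex.mul_conj'] at hz
      have : ‖z‖ ^ 2 = 1 := by exact_mod_cast hz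
      exact (pow_eq_one_iff_of_nonneg (norm_nonneg z) two_ne_zero).mp this
    intro x
    fin_cases x
    · exact key _ (by rw [mul_comm]; exact h00)
    · exact key _ h11

/-- If two numbers of modulus one average to zero for some probability weights, they are
opposite. -/
theorem add_eq_zero_of_weighted {p q : ℝ} (hp : 0 ≤ p) (hq : 0 ≤ q) (hpq : p + q = 1)
    {x y : ℂ} (hx : ‖x‖ = 1) (hy : ‖y‖ = 1) (h : p * x + q * y = 0) : x + y = 0 := by
  have hn : ‖(p : ℂ) * x‖ = ‖(q : ℂ) * y‖ := by rw [eq_neg_of_add_eq_zero_left h, norm_neg]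
  simp only [norm_mul, hx, hy, mul_one, Complex.norm_real, Real.norm_eq_abs, abs_of_nonneg hp,
    abs_of_nonneg hq] at hn
  have hp' : p = 1 / 2 := by linarith
  have hq' : q = 1 / 2 := by linarith
  subst hp' hq'
  push_cast at h
  linear_combination 2 * h

/-- A probability vector on bit strings, all of whose nontrivial correlations with unimodular
single-site functions vanish, is uniform. -/
theorem uniform_of_correlations {n : ℕ} (p : (Fin n → Bool) → ℝ) (hp : ∀ i, 0 ≤ p i)
    (hsum : ∑ i, p i = 1) (d : Fin n → Fin 2 → ℂ) (hd : ∀ k x, ‖d k x‖ = 1)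
    (h : ∀ b : Fin n → Bool, b ≠ (fun _ => false) →
      ∑ i, (∏ k, if b k then d k (bIdx (i k)) else 1) * (p i : ℂ) = 0) (i : Fin n → Bool) :
    (p i : ℂ) = (2 ^ n)⁻¹ := by
  have hopp : ∀ k, d k 0 + d k 1 = 0 := fun k => by
    have hk := h (fun l => decide (l = k)) fun e => by simpa using congrFun e k
    simp only [decide_eq_true_eq, Finset.prod_ite_eq', Finset.mem_univ, if_true] at hk
    have hsplit : ∀ f : (Fin n → Bool) → ℂ,
        ∑ i, f i = (∑ i : Fin n → Bool, if i k then 0 else f i) +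
          ∑ i : Fin n → Bool, if i k then f i else 0 := fun f => by
      rw [← Finset.sum_add_distrib]
      exact Finset.sum_congr rfl fun i _ => by cases i k <;> simp
    refine add_eq_zero_of_weighted (p := ∑ i : Fin n → Bool, if i k then 0 else p i)
      (q := ∑ i : Fin n → Bool, if i k then p i else 0)
      (Finset.sum_nonneg fun i _ => by split_ifs <;> simp [hp])
      (Finset.sum_nonneg fun i _ => by split_ifs <;> simp [hp]) ?_ (hd k 0) (hd k 1) ?_
    · rw [← hsum, ← Finset.sum_add_distrib]
      exact Finset.sum_congr rfl fun i _ => by cases i k <;> simp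
    · rw [hsplit] at hk
      push_cast
      rw [← hk, Finset.sum_mul, Finset.sum_mul]
      congr 1 <;> refine Finset.sum_congr rfl fun i _ => ?_ <;>
        cases i k <;> simp [bIdx, mul_comm]
  set A : Fin n → Matrix (Fin 2) (Fin 2) ℂ := fun k => !![1, 1; d k 0, d k 1] with hA
  set B : Fin n → Matrix (Fin 2) (Fin 2) ℂ :=
    fun k => !![2⁻¹, 2⁻¹ * (d k 0)⁻¹; 2⁻¹, 2⁻¹ * (d k 1)⁻¹] with hB
  have hBA : tensorMatrix B * tensorMatrix A = 1 := by
    rw [tensorMatrix_mul, ← tensorMatrix_one]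
    congr 1
    funext k
    have h0 : d k 0 ≠ 0 := norm_ne_zero_iff.mp (by simp [hd])
    have h1 : d k 1 = -d k 0 := by linear_combination hopp k
    ext x y
    fin_cases x <;> fin_cases y <;> simp [hA, hB, mul_apply, Fin.sum_univ_two, h1] <;>
      field_simp <;> norm_num
  have hAp : tensorMatrix A *ᵥ (fun i => (p i : ℂ)) = Pi.single (fun _ => false) 1 := by
    funext b
    have hrow : ∀ (i : Fin n → Bool) (k : Fin n), A k (bIdx (b k)) (bIdx (i k)) =
        if b k then d k (bIdx (i k)) else 1 := fun i k => by
      cases b k <;> cases i k <;> simp [hA, bIdx]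
    simp only [mulVec, dotProduct, tensorMatrix, of_apply, hrow]
    by_cases hb : b = fun _ => false
    · subst hb
      simp only [Bool.false_eq_true, if_false, Finset.prod_const_one, one_mul, Pi.single_eq_same]
      exact_mod_cast hsum
    · rw [h b hb, Pi.single_eq_of_ne hb]
  have hp' : (fun i => (p i : ℂ)) = tensorMatrix B *ᵥ Pi.single (fun _ => false) 1 := by
    rw [← hAp, mulVec_mulVec, hBA, one_mulVec]
  rw [congrFun hp' i, mulVec_single_one]
  have hcol : ∀ k, B k (bIdx (i k)) (bIdx false) = 2⁻¹ := fun k => by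
    cases i k <;> simp [hB, bIdx]
  simp [tensorMatrix, hcol]

theorem star_dotProduct_diagonal_mulVec {ι : Type*} [Fintype ι] [DecidableEq ι] (g φ : ι → ℂ) :
    star φ ⬝ᵥ (diagonal g *ᵥ φ) = ∑ i, g i * ((‖φ i‖ ^ 2 : ℝ) : ℂ) := by
  refine Finset.sum_congr rfl fun i _ => ?_
  rw [mulVec_diagonal]
  push_cast
  rw [← Complex.conj_mul']
  simp only [Pi.star_apply, RCLike.star_def]
  ring

theorem sqrt_two_inv_pow_mul_self (n : ℕ) :
    (Real.sqrt 2 : ℂ)⁻¹ ^ n * (Real.sqrt 2 : ℂ)⁻¹ ^ n = (2 ^ n)⁻¹ := by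
  have h : (Real.sqrt 2 : ℂ) * Real.sqrt 2 = 2 := by
    exact_mod_cast Real.mul_self_sqrt (by norm_num : (0 : ℝ) ≤ 2)
  rw [← mul_pow, ← mul_inv, h, inv_pow]

/-- The states obtained from a locally maximally entanglable state by the local unitaries
are orthonormal. -/
theorem IsLME.orthonormal {n : ℕ} {ψ : (Fin n → Bool) → ℂ}
    {U : Fin n → Bool → Matrix (Fin 2) (Fin 2) ℂ}
    (h : ∀ i i' : Fin n → Bool,
      (∑ a : Fin n → Bool,
        ((Real.sqrt 2 : ℂ)⁻¹ ^ n * tensorAction (fun k => U k (a k)) ψ i) *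
          (starRingEnd ℂ) ((Real.sqrt 2 : ℂ)⁻¹ ^ n * tensorAction (fun k => U k (a k)) ψ i')) =
      if i = i' then ((2 : ℂ) ^ n)⁻¹ else 0) (a b : Fin n → Bool) :
    star ψ ⬝ᵥ (tensorMatrix (fun k => (U k (a k))ᴴ * U k (b k)) *ᵥ ψ) =
      if a = b then 1 else 0 := by
  set M : Matrix (Fin n → Bool) (Fin n → Bool) ℂ :=
    of fun i a => tensorAction (fun k => U k (a k)) ψ i with hM
  have hMM : M * Mᴴ = 1 := by
    ext i i'
    have h2 : ((2 : ℂ) ^ n) ≠ 0 := pow_ne_zero _ two_ne_zero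
    have hs : ∑ a : Fin n → Bool, ((Real.sqrt 2 : ℂ)⁻¹ ^ n * M i a) *
          (starRingEnd ℂ) ((Real.sqrt 2 : ℂ)⁻¹ ^ n * M i' a) =
        (2 ^ n)⁻¹ * ∑ a, M i a * (starRingEnd ℂ) (M i' a) := by
      rw [Finset.mul_sum, ← sqrt_two_inv_pow_mul_self]
      refine Finset.sum_congr rfl fun a _ => ?_
      simp only [map_mul, map_pow, map_inv₀, Complex.conj_ofReal]
      ring
    have hi := hs.symm.trans (h i i')
    rw [mul_apply, one_apply]
    simp only [conjTranspose_apply, RCLike.star_def]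
    apply mul_left_cancel₀ (inv_ne_zero h2)
    rw [hi]
    split_ifs <;> simp
  have hM' : Mᴴ * M = 1 := mul_eq_one_comm.mp hMM
  have hMM' := congrFun (congrFun hM' a) b
  rw [one_apply] at hMM'
  rw [← hMM', ← tensorMatrix_mul, ← tensorMatrix_conjTranspose, ← mulVec_mulVec,
    dotProduct_mulVec, ← star_mulVec]
  rfl

/-- An `n`-qubit state `ψ` is locally maximally entanglable iff `ψ` is
local-unitary equivalent to a state all of whose computational-basis coefficients are
phases, i.e. iff there are 2×2 unitaries `V₁, …, Vₙ` and real phases `α` with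
`ψ = (V₁ ⊗ ⋯ ⊗ Vₙ) φ` where `φ(i) = 2^{-n/2} · exp(I·α(i))`. -/
theorem lme_iff_lu_equivalent_to_phase_state (n : ℕ) (ψ : (Fin n → Bool) → ℂ)
    (hψ : hinner ψ ψ = 1) :
    IsLME ψ ↔
      ∃ V : Fin n → Matrix (Fin 2) (Fin 2) ℂ,
        (∀ k, V k ∈ Matrix.unitaryGroup (Fin 2) ℂ) ∧
        ∃ α : (Fin n → Bool) → ℝ,
          ψ = tensorAction V
            (fun i => (Real.sqrt 2 : ℂ)⁻¹ ^ n * Complex.exp (Complex.I * (α i))) := by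
  constructor
  · rintro ⟨U, hU, h⟩
    have hW : ∀ k, (U k false)ᴴ * U k true ∈ unitaryGroup (Fin 2) ℂ := fun k =>
      mul_mem (Unitary.star_mem (hU k false)) (hU k true)
    choose V hV d hWd hd using fun k => exists_unitary_diagonal (hW k)
    set φ := tensorMatrix (fun k => (V k)ᴴ) *ᵥ ψ with hφ
    have hψφ : ψ = tensorMatrix V *ᵥ φ := by
      rw [hφ, mulVec_mulVec, tensorMatrix_mul]
      simp only [unitary_mul_conjTranspose (hV _), tensorMatrix_one, one_mulVec]
    have hexp : ∀ g : Fin n → Fin 2 → ℂ,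
        star ψ ⬝ᵥ (tensorMatrix (fun k => V k * diagonal (g k) * (V k)ᴴ) *ᵥ ψ) =
          ∑ i, (∏ k, g k (bIdx (i k))) * ((‖φ i‖ ^ 2 : ℝ) : ℂ) := fun g => by
      rw [← star_dotProduct_diagonal_mulVec, ← tensorMatrix_diagonal,
        ← tensorMatrix_mul (fun k => V k * diagonal (g k)), ← tensorMatrix_mul V,
        ← mulVec_mulVec, ← mulVec_mulVec, dotProduct_mulVec, ← hφ, hφ, star_mulVec,
        tensorMatrix_conjTranspose]
      simp only [conjTranspose_conjTranspose]
    have hE : ∀ b : Fin n → Bool, (fun k => (U k false)ᴴ * U k (b k)) =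
        fun k => V k * diagonal (fun x => if b k then d k x else 1) * (V k)ᴴ := fun b => by
      funext k
      cases b k
      · simp [unitary_conjTranspose_mul (hU k false), unitary_mul_conjTranspose (hV k)]
      · simpa using hWd k
    have hcorr : ∀ b : Fin n → Bool,
        ∑ i, (∏ k, if b k then d k (bIdx (i k)) else 1) * ((‖φ i‖ ^ 2 : ℝ) : ℂ) =
          if (fun _ => false) = b then 1 else 0 := fun b => by
      rw [← IsLME.orthonormal h (fun _ => false) b, hE b, hexp]
    have hsum : ∑ i, ‖φ i‖ ^ 2 = 1 := by
      have h0 := hcorr fun _ => false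
      simp only [Bool.false_eq_true, if_false, Finset.prod_const_one, one_mul, if_true] at h0
      exact_mod_cast h0
    have hunif := uniform_of_correlations (fun i => ‖φ i‖ ^ 2) (fun i => sq_nonneg _) hsum d hd
      fun b hb => by rw [hcorr b, if_neg hb.symm]
    refine ⟨V, hV, fun i => arg (φ i), ?_⟩
    rw [tensorAction_eq_mulVec]
    refine hψφ.trans (congrArg _ (funext fun i => ?_))
    have hr : ‖φ i‖ = (Real.sqrt 2)⁻¹ ^ n := by
      have h1 := hunif i
      rw [← sqrt_two_inv_pow_mul_self] at h1
      have h2 : ‖φ i‖ ^ 2 = ((Real.sqrt 2)⁻¹ ^ n) ^ 2 := by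
        rw [sq ((Real.sqrt 2)⁻¹ ^ n)]; exact_mod_cast h1
      exact (pow_left_inj₀ (norm_nonneg _) (by positivity) two_ne_zero).mp h2
    have h3 := Complex.norm_mul_exp_arg_mul_I (φ i)
    rw [hr] at h3
    push_cast at h3
    rw [mul_comm Complex.I, h3]
  · rintro ⟨V, hV, α, rfl⟩
    set φ : (Fin n → Bool) → ℂ :=
      fun i => (Real.sqrt 2 : ℂ)⁻¹ ^ n * Complex.exp (Complex.I * (α i)) with hφ
    set g : Bool → Fin 2 → ℂ := fun b => if b then ![1, -1] else ![1, 1] with hg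
    have hφφ : ∀ i, φ i * (starRingEnd ℂ) (φ i) = (2 ^ n)⁻¹ := fun i => by
      have he : Complex.exp (Complex.I * (α i)) * Complex.exp (-(Complex.I * (α i))) = 1 := by
        rw [← Complex.exp_add, add_neg_cancel, Complex.exp_zero]
      rw [hφ, ← sqrt_two_inv_pow_mul_self]
      simp only [map_mul, map_pow, map_inv₀, Complex.conj_ofReal, ← Complex.exp_conj,
        Complex.conj_I, neg_mul]
      linear_combination ((Real.sqrt 2 : ℂ)⁻¹ ^ n * (Real.sqrt 2 : ℂ)⁻¹ ^ n) * he
    refine ⟨fun k b => diagonal (g b) * (V k)ᴴ, fun k b => mul_mem ?_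
      (Unitary.star_mem (hV k)), fun i i' => ?_⟩
    · rw [mem_unitaryGroup_iff]
      ext x y
      cases b <;> fin_cases x <;> fin_cases y <;>
        simp [hg, mul_apply, Fin.sum_univ_two, star_apply]
    · have hT : ∀ a : Fin n → Bool,
          tensorAction (fun k => diagonal (g (a k)) * (V k)ᴴ) (tensorAction V φ) =
            fun i => (∏ k, g (a k) (bIdx (i k))) * φ i := fun a => by
        rw [tensorAction_eq_mulVec, tensorAction_eq_mulVec, mulVec_mulVec, tensorMatrix_mul]
        simp only [Matrix.mul_assoc, unitary_conjTranspose_mul (hV _), Matrix.mul_one]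
        rw [tensorMatrix_diagonal fun k => g (a k)]
        exact funext fun i => mulVec_diagonal _ _ _
      have hterm : ∀ a : Fin n → Bool,
          ((Real.sqrt 2 : ℂ)⁻¹ ^ n * ((∏ k, g (a k) (bIdx (i k))) * φ i)) *
            (starRingEnd ℂ) ((Real.sqrt 2 : ℂ)⁻¹ ^ n * ((∏ k, g (a k) (bIdx (i' k))) * φ i')) =
          (2 ^ n)⁻¹ * (φ i * (starRingEnd ℂ) (φ i')) *
            ∏ k, g (a k) (bIdx (i k)) * g (a k) (bIdx (i' k)) := fun a => by
        have hgc : ∀ b x, (starRingEnd ℂ) (g b x) = g b x := fun b x => by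
          cases b <;> fin_cases x <;> simp [hg]
        rw [← sqrt_two_inv_pow_mul_self, Finset.prod_mul_distrib]
        simp only [map_mul, map_pow, map_inv₀, Complex.conj_ofReal, map_prod, hgc]
        ring
      simp only [hT, hterm]
      rw [← Finset.mul_sum, sum_prod_bool fun k b => g b (bIdx (i k)) * g b (bIdx (i' k))]
      split_ifs with hi
      · subst hi
        have hk : ∀ k, ∑ b, g b (bIdx (i k)) * g b (bIdx (i k)) = 2 := fun k => by
          cases i k <;> simp [hg, bIdx] <;> norm_num
        rw [hφφ, Finset.prod_congr rfl fun k _ => hk k]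
        simp
      · obtain ⟨k, hk⟩ := Function.ne_iff.mp hi
        rw [Finset.prod_eq_zero (Finset.mem_univ k), mul_zero]
        revert hk
        cases i k <;> cases i' k <;> simp [hg, bIdx]
end
end

section
/- Let ψ : (Fin n → Bool) → ℂ satisfy |ψ(i)|² = 2^{-n} for every i. Then the 2^n vectors Z^{⊗s} ψ, indexed by s : Fin n → Bool, form an orthonormal basis of ℂ^{2^n}. (Consequently, n parties sharing ψ can locally encode n classical bits into 2^n globally perfectly distinguishable states by each applying the identity or Z to their own qubit.) -/
open Complex

noncomputable section

/-- The diagonal action of `Z^{⊗s}` (the tensor product over `k` of `Z^{s_k}`, with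
`Z = diag(1,−1)`): `(Z^{⊗s} ψ)(i) = (−1)^{Σ_k s_k i_k} ψ(i)`. -/
def zAct {n : ℕ} (s : Fin n → Bool) (ψ : (Fin n → Bool) → ℂ) : (Fin n → Bool) → ℂ :=
  fun i => (∏ k, if s k && i k then (-1 : ℂ) else 1) * ψ i

/-- Orthogonality of the characters of `(ℤ/2)^n`. -/
lemma sum_prod_sign_mul_sign {n : ℕ} (s t : Fin n → Bool) :
    ∑ i : Fin n → Bool, ∏ k, ((if s k && i k then (-1 : ℂ) else 1) *
      (if t k && i k then (-1 : ℂ) else 1)) = if s = t then 2 ^ n else 0 := by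
  rw [← Fintype.prod_sum (fun k (b : Bool) => (if s k && b then (-1 : ℂ) else 1) *
    (if t k && b then (-1 : ℂ) else 1))]
  have hk : ∀ k, ∑ b : Bool, ((if s k && b then (-1 : ℂ) else 1) *
      (if t k && b then (-1 : ℂ) else 1)) = if s k = t k then 2 else 0 := by
    intro k
    cases s k <;> cases t k <;> norm_num
  simp_rw [hk]
  split_ifs with hst
  · simp [hst]
  · obtain ⟨k, hne⟩ := Function.ne_iff.mp hst
    exact Finset.prod_eq_zero (Finset.mem_univ k) (if_neg hne)

lemma hinner_zAct_zAct {n : ℕ} {ψ : (Fin n → Bool) → ℂ}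
    (h : ∀ i : Fin n → Bool, ‖ψ i‖ ^ 2 = ((2 : ℝ) ^ n)⁻¹) (s t : Fin n → Bool) :
    hinner (zAct s ψ) (zAct t ψ) = if s = t then 1 else 0 := by
  have hψ : ∀ i, (starRingEnd ℂ) (ψ i) * ψ i = ((2 : ℂ) ^ n)⁻¹ := by
    intro i
    rw [Complex.conj_mul', ← Complex.ofReal_pow, h i]
    push_cast
    rfl
  have hterm : ∀ i, (starRingEnd ℂ) (zAct s ψ i) * zAct t ψ i =
      (∏ k, ((if s k && i k then (-1 : ℂ) else 1) *
        (if t k && i k then (-1 : ℂ) else 1))) * ((2 : ℂ) ^ n)⁻¹ := by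
    intro i
    rw [← hψ i, Finset.prod_mul_distrib]
    simp only [zAct, map_mul, map_prod, apply_ite (starRingEnd ℂ), map_neg, map_one]
    ring
  simp_rw [hinner, hterm, ← Finset.sum_mul, sum_prod_sign_mul_sign]
  split_ifs <;> simp

lemma linearIndependent_of_hinner_eq_ite {ι κ : Type*} [Fintype ι] [DecidableEq κ]
    {v : κ → ι → ℂ} (hv : ∀ a b, hinner (v a) (v b) = if a = b then 1 else 0) :
    LinearIndependent ℂ v := by
  rw [linearIndependent_iff']
  intro F g hg a ha
  have hsum : hinner (v a) (∑ b ∈ F, g b • v b) = ∑ b ∈ F, g b * hinner (v a) (v b) := by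
    simp only [hinner, Finset.sum_apply, Pi.smul_apply, smul_eq_mul, Finset.mul_sum]
    rw [Finset.sum_comm]
    exact Finset.sum_congr rfl fun b _ => Finset.sum_congr rfl fun i _ => by ring
  have hzero : hinner (v a) 0 = 0 := by simp [hinner]
  rw [hg, hzero] at hsum
  simpa [hv, ha] using hsum.symm

/-- if all amplitudes of `ψ` satisfy `|ψ(i)|² = 2^{-n}`, then the `2^n`
vectors `Z^{⊗s} ψ`, for `s : Fin n → Bool`, form an orthonormal basis of `ℂ^{2^n}`
(they are pairwise orthonormal and they span). -/
theorem z_orbit_is_onbasis (n : ℕ) (ψ : (Fin n → Bool) → ℂ)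
    (h : ∀ i : Fin n → Bool, ‖ψ i‖ ^ 2 = ((2 : ℝ) ^ n)⁻¹) :
    (∀ s t : Fin n → Bool, hinner (zAct s ψ) (zAct t ψ) = if s = t then 1 else 0) ∧
      Submodule.span ℂ (Set.range fun s : Fin n → Bool => zAct s ψ) = ⊤ := by
  refine ⟨hinner_zAct_zAct h, ?_⟩
  exact (linearIndependent_of_hinner_eq_ite (hinner_zAct_zAct h)).span_eq_top_of_card_eq_finrank'
    (by simp)
end
end

section
/- Let λ ∈ ℝ with 0 ≤ λ ≤ 1 and λ ≠ 1/2, let ρ = diag(λ, 1−λ), and let U be a 2×2 unitary matrix satisfying ρ + U ρ U† = I. Then both diagonal entries of U are zero; equivalently, there exist α, θ ∈ ℝ such that U = e^{iθ} · e^{i(α/2)Z} X e^{−i(α/2)Z}, where X = [[0,1],[1,0]] and Z = diag(1,−1). -/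
open Complex

noncomputable section

/-- The Pauli `X` matrix. -/
def PX : Matrix (Fin 2) (Fin 2) ℂ := !![0, 1; 1, 0]

/-- `e^{iβZ} = diag(e^{iβ}, e^{−iβ})`. -/
def eZ (β : ℝ) : Matrix (Fin 2) (Fin 2) ℂ :=
  !![Complex.exp (Complex.I * β), 0; 0, Complex.exp (-(Complex.I * β))]

/-- let `0 ≤ λ ≤ 1`, `λ ≠ 1/2`, `ρ = diag(λ, 1−λ)`, and let `U` be a 2×2
unitary with `ρ + U ρ U† = I`. Then both diagonal entries of `U` vanish; equivalently
`U = e^{iθ} e^{i(α/2)Z} X e^{−i(α/2)Z}` for some reals `α, θ`. -/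
theorem washing_unitary_is_offdiagonal (lam : ℝ) (h0 : 0 ≤ lam) (h1 : lam ≤ 1)
    (hne : lam ≠ 1 / 2) (U : Matrix (Fin 2) (Fin 2) ℂ)
    (hU : U ∈ Matrix.unitaryGroup (Fin 2) ℂ)
    (hwash : !![(lam : ℂ), 0; 0, 1 - (lam : ℂ)] +
        U * !![(lam : ℂ), 0; 0, 1 - (lam : ℂ)] * star U = 1) :
    (U 0 0 = 0 ∧ U 1 1 = 0) ∧
      ∃ α θ : ℝ, U = Complex.exp (Complex.I * θ) • (eZ (α / 2) * PX * eZ (-(α / 2))) := by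
  have hrow : ∀ i, (normSq (U i 0) : ℂ) + normSq (U i 1) = 1 := fun i => by
    have h := congrFun (congrFun (Matrix.mem_unitaryGroup_iff.mp hU) i) i
    simpa [Matrix.mul_apply, Fin.sum_univ_two, Matrix.star_apply, mul_conj] using h
  have hrow' : ∀ i, normSq (U i 0) + normSq (U i 1) = 1 := fun i => by
    exact_mod_cast hrow i
  have hne' : 2 * lam - 1 ≠ 0 := fun h => hne (by linarith)
  have hconj : ∀ (z : ℂ) (r : ℝ), z * r * (starRingEnd ℂ) z = (normSq z * r : ℝ) := fun z r => by
    rw [mul_right_comm, mul_conj]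
    push_cast
    rfl
  have hsub : (1 - (lam : ℂ)) = ((1 - lam : ℝ) : ℂ) := by push_cast; rfl
  rw [hsub] at hwash
  have hdiag0 : lam + (normSq (U 0 0) * lam + normSq (U 0 1) * (1 - lam)) = 1 := by
    have h := congrFun (congrFun hwash 0) 0
    simp only [Matrix.add_apply, Matrix.mul_apply, Fin.sum_univ_two, Matrix.star_apply] at h
    simp [-ofReal_sub, hconj, -ofReal_mul] at h
    exact_mod_cast h
  have hdiag1 : (1 - lam) + (normSq (U 1 0) * lam + normSq (U 1 1) * (1 - lam)) = 1 := by
    have h := congrFun (congrFun hwash 1) 1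
    simp only [Matrix.add_apply, Matrix.mul_apply, Fin.sum_univ_two, Matrix.star_apply] at h
    simp [-ofReal_sub, hconj, -ofReal_mul] at h
    exact_mod_cast h
  have hU00 : U 0 0 = 0 := normSq_eq_zero.mp <| (mul_eq_zero.mp
    (by linear_combination hdiag0 - (1 - lam) * hrow' 0 :
      normSq (U 0 0) * (2 * lam - 1) = 0)).resolve_right hne'
  have hU11 : U 1 1 = 0 := normSq_eq_zero.mp <| (mul_eq_zero.mp
    (by linear_combination lam * hrow' 1 - hdiag1 :
      normSq (U 1 1) * (2 * lam - 1) = 0)).resolve_right hne'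
  have hpolar : ∀ z : ℂ, normSq z = 1 → z = exp (I * arg z) := fun z hz => by
    have hz' : ‖z‖ = 1 := by
      rw [normSq_eq_norm_sq] at hz
      exact (pow_eq_one_iff_of_nonneg (norm_nonneg z) two_ne_zero).mp hz
    simpa [hz', mul_comm] using (norm_mul_exp_arg_mul_I z).symm
  have hU01 := hpolar (U 0 1) (by simpa [hU00] using hrow' 0)
  have hU10 := hpolar (U 1 0) (by simpa [hU11] using hrow' 1)
  refine ⟨⟨hU00, hU11⟩, (arg (U 0 1) - arg (U 1 0)) / 2, (arg (U 0 1) + arg (U 1 0)) / 2, ?_⟩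
  ext i j
  fin_cases i <;> fin_cases j
  · simp [hU00, eZ, PX]
  · simp only [eZ, PX, Matrix.smul_apply, Matrix.mul_apply, Fin.sum_univ_two]
    simp [← exp_add]
    refine hU01.trans (congrArg exp ?_)
    ring
  · simp only [eZ, PX, Matrix.smul_apply, Matrix.mul_apply, Fin.sum_univ_two]
    simp [← exp_add]
    refine hU10.trans (congrArg exp ?_)
    ring
  · simp [hU11, eZ, PX]
end
end

section
/- Let W = (|001⟩ + |010⟩ + |100⟩)/√3 be the three-qubit W state, and for a real α let U(α) = e^{iαZ} X e^{−iαZ} = [[0, e^{2iα}],[e^{−2iα}, 0]]. Then for all real α₁, α₂, the expectation value ⟨W, (U(α₁) ⊗ U(α₂) ⊗ I) W⟩ = (2/3)·cos(2(α₁ − α₂)); in particular it is never zero simultaneously for all three pairs of sites. -/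
open Complex

noncomputable section

/-- `U(α) = e^{iαZ} X e^{−iαZ} = [[0, e^{2iα}],[e^{−2iα}, 0]]`. -/
def Ua (α : ℝ) : Matrix (Fin 2) (Fin 2) ℂ := eZ α * PX * eZ (-α)

/-- The three-qubit `W` state `(|001⟩ + |010⟩ + |100⟩)/√3`. -/
def Wstate : (Fin 3 → Bool) → ℂ :=
  fun i => if (∑ k, (if i k then 1 else 0 : ℕ)) = 1 then (Real.sqrt 3 : ℂ)⁻¹ else 0

theorem sum_fin_three_bool {M : Type*} [AddCommMonoid M] (f : (Fin 3 → Bool) → M) :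
    ∑ i, f i = ∑ a, ∑ b, ∑ c, f ![a, b, c] := by
  let e : (Bool × Bool × Bool) ≃ (Fin 3 → Bool) :=
    { toFun := fun p => ![p.1, p.2.1, p.2.2]
      invFun := fun i => (i 0, i 1, i 2)
      left_inv := fun _ => rfl
      right_inv := fun i => by ext k; fin_cases k <;> rfl }
  rw [← e.sum_comp]
  simp only [Fintype.sum_prod_type]
  rfl

theorem Wstate_vecCons (a b c : Bool) :
    Wstate ![a, b, c] =
      if a.toNat + b.toNat + c.toNat = 1 then (Real.sqrt 3 : ℂ)⁻¹ else 0 := by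
  cases a <;> cases b <;> cases c <;> rw [Wstate, Fin.sum_univ_three] <;> rfl

theorem tensorAction_vecCons (A B C : Matrix (Fin 2) (Fin 2) ℂ) (ψ : (Fin 3 → Bool) → ℂ)
    (a b c : Bool) :
    tensorAction ![A, B, C] ψ ![a, b, c] = ∑ a', ∑ b', ∑ c',
      A (bIdx a) (bIdx a') * B (bIdx b) (bIdx b') * C (bIdx c) (bIdx c') * ψ ![a', b', c'] := by
  simp only [tensorAction, sum_fin_three_bool, Fin.prod_univ_three]
  rfl

theorem hinner_Wstate_tensorAction (A B C : Matrix (Fin 2) (Fin 2) ℂ) :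
    hinner Wstate (tensorAction ![A, B, C] Wstate) = (1 / 3 : ℂ) *
      (A 1 1 * B 0 0 * C 0 0 + A 1 0 * B 0 1 * C 0 0 + A 1 0 * B 0 0 * C 0 1 +
        A 0 1 * B 1 0 * C 0 0 + A 0 0 * B 1 1 * C 0 0 + A 0 0 * B 1 0 * C 0 1 +
        A 0 1 * B 0 0 * C 1 0 + A 0 0 * B 0 1 * C 1 0 + A 0 0 * B 0 0 * C 1 1) := by
  have h : ((Real.sqrt 3 : ℂ)⁻¹) ^ 2 = 1 / 3 := by
    rw [inv_pow, ← Complex.ofReal_pow, Real.sq_sqrt (by norm_num)]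
    norm_num
  rw [← h]
  simp [hinner, tensorAction_vecCons, sum_fin_three_bool, Wstate_vecCons, bIdx]
  ring

theorem Ua_eq (α : ℝ) :
    Ua α = !![0, Complex.exp (2 * α * Complex.I); Complex.exp (-(2 * α * Complex.I)), 0] := by
  ext i j
  fin_cases i <;> fin_cases j <;>
    simp [Ua, eZ, PX, Matrix.mul_apply, Fin.sum_univ_two, ← Complex.exp_add] <;> ring_nf

theorem exp_mul_exp_neg_add_symm (α β : ℝ) :
    Complex.exp (2 * α * Complex.I) * Complex.exp (-(2 * β * Complex.I)) +
      Complex.exp (-(2 * α * Complex.I)) * Complex.exp (2 * β * Complex.I) =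
        2 * Real.cos (2 * (α - β)) := by
  rw [Complex.ofReal_cos, Complex.two_cos, ← Complex.exp_add, ← Complex.exp_add]
  push_cast
  ring_nf

theorem hinner_Wstate_Ua_Ua_one (α β : ℝ) :
    hinner Wstate (tensorAction ![Ua α, Ua β, (1 : Matrix (Fin 2) (Fin 2) ℂ)] Wstate) =
      (2 / 3 : ℂ) * Real.cos (2 * (α - β)) := by
  rw [hinner_Wstate_tensorAction, Ua_eq, Ua_eq]
  simp only [Matrix.of_apply, Matrix.cons_val', Matrix.cons_val_zero, Matrix.cons_val_one,
    Matrix.cons_val_fin_one, Matrix.one_apply_eq]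
  linear_combination (1 / 3 : ℂ) * exp_mul_exp_neg_add_symm α β

theorem hinner_Wstate_Ua_one_Ua (α β : ℝ) :
    hinner Wstate (tensorAction ![Ua α, (1 : Matrix (Fin 2) (Fin 2) ℂ), Ua β] Wstate) =
      (2 / 3 : ℂ) * Real.cos (2 * (α - β)) := by
  rw [hinner_Wstate_tensorAction, Ua_eq, Ua_eq]
  simp only [Matrix.of_apply, Matrix.cons_val', Matrix.cons_val_zero, Matrix.cons_val_one,
    Matrix.cons_val_fin_one, Matrix.one_apply_eq]
  linear_combination (1 / 3 : ℂ) * exp_mul_exp_neg_add_symm α β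

theorem hinner_Wstate_one_Ua_Ua (α β : ℝ) :
    hinner Wstate (tensorAction ![(1 : Matrix (Fin 2) (Fin 2) ℂ), Ua α, Ua β] Wstate) =
      (2 / 3 : ℂ) * Real.cos (2 * (α - β)) := by
  rw [hinner_Wstate_tensorAction, Ua_eq, Ua_eq]
  simp only [Matrix.of_apply, Matrix.cons_val', Matrix.cons_val_zero, Matrix.cons_val_one,
    Matrix.cons_val_fin_one, Matrix.one_apply_eq]
  linear_combination (1 / 3 : ℂ) * exp_mul_exp_neg_add_symm α β

theorem cos_add_ne_zero_of_cos_eq_zero {x y : ℝ} (hx : Real.cos x = 0) (hy : Real.cos y = 0) :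
    Real.cos (x + y) ≠ 0 := by
  intro h
  have hx' := Real.sin_sq_add_cos_sq x
  have hy' := Real.sin_sq_add_cos_sq y
  rw [Real.cos_add] at h
  rcases (show Real.sin x = 0 ∨ Real.sin y = 0 by simpa [hx, hy] using h) with h | h <;>
    simp_all

/-- `⟨W, (U(α₁) ⊗ U(α₂) ⊗ I) W⟩ = (2/3)·cos(2(α₁ − α₂))`; in particular
these expectation values cannot vanish simultaneously for all three pairs of sites. -/
theorem W_state_two_site_expectation :
    (∀ α₁ α₂ : ℝ,
      hinner Wstate (tensorAction ![Ua α₁, Ua α₂, (1 : Matrix (Fin 2) (Fin 2) ℂ)] Wstate) =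
        (2 / 3 : ℂ) * Real.cos (2 * (α₁ - α₂))) ∧
    ¬ ∃ α₁ α₂ α₃ : ℝ,
        hinner Wstate (tensorAction ![Ua α₁, Ua α₂, (1 : Matrix (Fin 2) (Fin 2) ℂ)] Wstate)
            = 0 ∧
        hinner Wstate (tensorAction ![Ua α₁, (1 : Matrix (Fin 2) (Fin 2) ℂ), Ua α₃] Wstate)
            = 0 ∧
        hinner Wstate (tensorAction ![(1 : Matrix (Fin 2) (Fin 2) ℂ), Ua α₂, Ua α₃] Wstate)
            = 0 := by
  refine ⟨hinner_Wstate_Ua_Ua_one, ?_⟩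
  rintro ⟨α₁, α₂, α₃, h₁₂, h₁₃, h₂₃⟩
  have cos_zero {x : ℝ} (h : (2 / 3 : ℂ) * Real.cos x = 0) : Real.cos x = 0 :=
    Complex.ofReal_eq_zero.mp ((mul_eq_zero.mp h).resolve_left (by norm_num))
  rw [hinner_Wstate_Ua_Ua_one] at h₁₂
  rw [hinner_Wstate_Ua_one_Ua] at h₁₃
  rw [hinner_Wstate_one_Ua_Ua] at h₂₃
  refine cos_add_ne_zero_of_cos_eq_zero (cos_zero h₁₂) (cos_zero h₂₃) ?_
  rw [← cos_zero h₁₃]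
  ring_nf
end
end

section
/- Let α : (Fin n → Bool) → ℝ, let ψ(i) = 2^{-n/2}·exp(I·α(i)) be the corresponding LME state, let U_ph be the diagonal unitary with entries exp(I·α(i)), and define the generalized stabilizer operators W_k = U_ph X_k U_ph† for k = 1,…,n, where X_k acts as Pauli X on qubit k and identity elsewhere. Then a vector φ ∈ ℂ^{2^n} satisfies W_k φ = φ for all k if and only if φ is a scalar multiple of ψ; i.e., the joint fixed subspace of W₁,…,Wₙ is the one-dimensional span of ψ. -/
open Complex

noncomputable section

/-- Flip the `k`-th bit of a bit string. -/
def flipBit {n : ℕ} (k : Fin n) (i : Fin n → Bool) : Fin n → Bool :=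
  Function.update i k (!(i k))

/-- The diagonal unitary `U_ph` with entries `exp(I·α(i))`. -/
def Uph {n : ℕ} (α : (Fin n → Bool) → ℝ) (φ : (Fin n → Bool) → ℂ) : (Fin n → Bool) → ℂ :=
  fun i => Complex.exp (Complex.I * α i) * φ i

/-- The adjoint `U_ph†`, the diagonal operator with entries `exp(−I·α(i))`. -/
def UphDag {n : ℕ} (α : (Fin n → Bool) → ℝ) (φ : (Fin n → Bool) → ℂ) :
    (Fin n → Bool) → ℂ :=
  fun i => Complex.exp (-(Complex.I * α i)) * φ i

/-- Pauli `X` acting on tensor factor `k` (identity elsewhere):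
`(X_k φ)(i) = φ(i with bit k flipped)`. -/
def Xk {n : ℕ} (k : Fin n) (φ : (Fin n → Bool) → ℂ) : (Fin n → Bool) → ℂ :=
  fun i => φ (flipBit k i)

/-- The generalized stabilizer operator `W_k = U_ph X_k U_ph†`. -/
def genStab {n : ℕ} (α : (Fin n → Bool) → ℝ) (k : Fin n) (φ : (Fin n → Bool) → ℂ) :
    (Fin n → Bool) → ℂ :=
  Uph α (Xk k (UphDag α φ))

/-- The LME state `ψ(i) = 2^{-n/2}·exp(I·α(i))`. -/
def lmeState {n : ℕ} (α : (Fin n → Bool) → ℝ) : (Fin n → Bool) → ℂ :=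
  fun i => (Real.sqrt 2 : ℂ)⁻¹ ^ n * Complex.exp (Complex.I * α i)

/-- A function invariant under every bit flip is constant. -/
theorem eq_of_flipBit_invariant {n : ℕ} {β : Type*} {f : (Fin n → Bool) → β}
    (hf : ∀ k i, f (flipBit k i) = f i) (i j : Fin n → Bool) : f i = f j := by
  have update_eq (i : Fin n → Bool) (k : Fin n) (b : Bool) : f (Function.update i k b) = f i := by
    by_cases hb : b = i k
    · rw [hb, Function.update_eq_self]
    · rw [Bool.eq_not.mpr hb]
      exact hf k i
  have piecewise_eq (s : Finset (Fin n)) : f (s.piecewise j i) = f i := by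
    induction s using Finset.induction_on with
    | empty => rw [Finset.piecewise_empty]
    | insert a s _ ih => rw [Finset.piecewise_insert, update_eq, ih]
  rw [← piecewise_eq Finset.univ, Finset.piecewise_univ]

/-- `U_ph` inverts its adjoint `U_ph†`. -/
theorem Uph_UphDag {n : ℕ} (α : (Fin n → Bool) → ℝ) (φ : (Fin n → Bool) → ℂ) :
    Uph α (UphDag α φ) = φ := by
  funext i
  rw [Uph, UphDag, ← mul_assoc, ← Complex.exp_add, add_neg_cancel, Complex.exp_zero, one_mul]

/-- The adjoint `U_ph†` inverts `U_ph`. -/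
theorem UphDag_Uph {n : ℕ} (α : (Fin n → Bool) → ℝ) (φ : (Fin n → Bool) → ℂ) :
    UphDag α (Uph α φ) = φ := by
  funext i
  rw [UphDag, Uph, ← mul_assoc, ← Complex.exp_add, neg_add_cancel, Complex.exp_zero, one_mul]

/-- `φ` is fixed by `W_k` iff `U_ph† φ` is fixed by `X_k`. -/
theorem genStab_eq_self_iff {n : ℕ} (α : (Fin n → Bool) → ℝ) (k : Fin n)
    (φ : (Fin n → Bool) → ℂ) :
    genStab α k φ = φ ↔ Xk k (UphDag α φ) = UphDag α φ := by
  constructor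
  · intro h
    conv_rhs => rw [← h, genStab, UphDag_Uph]
  · intro h
    rw [genStab, h, Uph_UphDag]

/-- The LME state is `U_ph` applied to a uniform superposition. -/
theorem smul_lmeState {n : ℕ} (α : (Fin n → Bool) → ℝ) (c : ℂ) :
    c • lmeState α = Uph α fun _ => c * (Real.sqrt 2 : ℂ)⁻¹ ^ n := by
  funext i
  simp only [Pi.smul_apply, smul_eq_mul, lmeState, Uph]
  ring

/-- a vector `φ` satisfies `W_k φ = φ` for all `k` iff `φ` is a scalar
multiple of the LME state `ψ`; i.e., the joint fixed subspace of the generalized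
stabilizers `W₁, …, Wₙ` is the one-dimensional span of `ψ`. -/
theorem genStab_fixed_space_is_span_of_lmeState (n : ℕ) (α : (Fin n → Bool) → ℝ)
    (φ : (Fin n → Bool) → ℂ) :
    (∀ k : Fin n, genStab α k φ = φ) ↔ ∃ c : ℂ, φ = c • lmeState α := by
  simp only [genStab_eq_self_iff, smul_lmeState]
  constructor
  · intro h
    have hconst := eq_of_flipBit_invariant fun k i => congrFun (h k) i
    have hsqrt : (Real.sqrt 2 : ℂ) ≠ 0 := by simp
    refine ⟨UphDag α φ (fun _ => false) * (Real.sqrt 2 : ℂ) ^ n, ?_⟩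
    rw [mul_assoc, ← mul_pow, mul_inv_cancel₀ hsqrt, one_pow, mul_one]
    conv_lhs => rw [← Uph_UphDag α φ]
    exact congrArg (Uph α) (funext fun i => hconst i _)
  · rintro ⟨c, rfl⟩ k
    rw [UphDag_Uph]
    rfl
end
end

section
/- Let α : (Fin n → Bool) → ℝ, let ψ(i) = 2^{-n/2}·exp(I·α(i)), let U_ph be the diagonal unitary with entries exp(I·α(i)), and define W_k = U_ph X_k U_ph†. Then the sum over the group generated by W₁,…,Wₙ, namely Σ_{s : Fin n → Bool} W₁^{s₁} W₂^{s₂} ⋯ Wₙ^{sₙ}, equals 2^n · |ψ⟩⟨ψ|, the projection onto the span of ψ scaled by 2^n. In particular, ψ is the unique ground state (up to phase) of the Hamiltonian H = I − 2^{-n} Σ_s W^s. -/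
open Complex

noncomputable section

/-- The group element `W^s = W₁^{s₁} W₂^{s₂} ⋯ Wₙ^{sₙ}` (with `W⁰ = id`), as the
composition of the generalized stabilizers selected by the bit string `s`. -/
def genStabProd {n : ℕ} (α : (Fin n → Bool) → ℝ) (s : Fin n → Bool) :
    ((Fin n → Bool) → ℂ) → ((Fin n → Bool) → ℂ) :=
  (List.ofFn fun k : Fin n => if s k then genStab α k else id).foldr (· ∘ ·) id

/-- Flip the bits of `i` selected by `s`. -/
def xorBits {n : ℕ} (i s : Fin n → Bool) : Fin n → Bool :=
  fun k => i k ^^ s k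

lemma xorBits_involutive {n : ℕ} (i : Fin n → Bool) : Function.Involutive (xorBits i) := by
  intro s
  funext k
  simp [xorBits]

lemma genStab_apply {n : ℕ} (α : (Fin n → Bool) → ℝ) (k : Fin n) (φ : (Fin n → Bool) → ℂ)
    (i : Fin n → Bool) :
    genStab α k φ i = Complex.exp (Complex.I * α i) *
      (Complex.exp (-(Complex.I * α (flipBit k i))) * φ (flipBit k i)) :=
  rfl

/-- A product of distinct generalized stabilizers selected by `s` flips the selected bits and
conjugates by the phases. -/
lemma foldr_genStab_apply {n : ℕ} (α : (Fin n → Bool) → ℝ) (s : Fin n → Bool)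
    (φ : (Fin n → Bool) → ℂ) (l : List (Fin n)) (hl : l.Nodup) (i : Fin n → Bool) :
    (l.map fun k => if s k then genStab α k else id).foldr (· ∘ ·) id φ i =
      Complex.exp (Complex.I * α i) *
        (Complex.exp (-(Complex.I * α (xorBits i fun k => decide (k ∈ l) && s k))) *
          φ (xorBits i fun k => decide (k ∈ l) && s k)) := by
  induction l generalizing i with
  | nil =>
    have h : (xorBits i fun _ => false) = i := by
      funext k
      simp [xorBits]
    simp [h, ← mul_assoc, ← Complex.exp_add]
  | cons a l ih =>
    obtain ⟨ha, hl⟩ := List.nodup_cons.mp hl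
    by_cases hs : s a = true
    · have h : (xorBits (flipBit a i) fun k => decide (k ∈ l) && s k) =
          xorBits i fun k => decide (k ∈ a :: l) && s k := by
        funext k
        by_cases hk : k = a
        · subst hk
          simp [xorBits, flipBit, ha, hs]
        · simp [xorBits, flipBit, hk]
      simp only [List.map_cons, List.foldr_cons, if_pos hs, Function.comp_apply]
      rw [genStab_apply, ih hl, h, ← mul_assoc (Complex.exp (-(Complex.I * α (flipBit a i)))),
        ← Complex.exp_add, neg_add_cancel, Complex.exp_zero, one_mul]
    · have h : (fun k => decide (k ∈ l) && s k) = fun k => decide (k ∈ a :: l) && s k := by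
        funext k
        by_cases hk : k = a
        · subst hk
          simp [hs]
        · simp [hk]
      simp only [List.map_cons, List.foldr_cons, if_neg hs, Function.comp_apply, id_eq]
      rw [ih hl, h]

lemma genStabProd_apply {n : ℕ} (α : (Fin n → Bool) → ℝ) (s : Fin n → Bool)
    (φ : (Fin n → Bool) → ℂ) (i : Fin n → Bool) :
    genStabProd α s φ i = Complex.exp (Complex.I * α i) *
      (Complex.exp (-(Complex.I * α (xorBits i s))) * φ (xorBits i s)) := by
  rw [genStabProd, List.ofFn_eq_map, foldr_genStab_apply α s φ _ (List.nodup_finRange n)]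
  simp

lemma conj_lmeState {n : ℕ} (α : (Fin n → Bool) → ℝ) (i : Fin n → Bool) :
    (starRingEnd ℂ) (lmeState α i) =
      (Real.sqrt 2 : ℂ)⁻¹ ^ n * Complex.exp (-(Complex.I * α i)) := by
  simp [lmeState, ← Complex.exp_conj]

lemma two_pow_mul_inv_sqrt_two_pow (n : ℕ) :
    (2 : ℂ) ^ n * ((Real.sqrt 2 : ℂ)⁻¹ ^ n * (Real.sqrt 2 : ℂ)⁻¹ ^ n) = 1 := by
  have h : (Real.sqrt 2 : ℂ) * (Real.sqrt 2 : ℂ) = 2 := by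
    rw [← Complex.ofReal_mul, Real.mul_self_sqrt (by norm_num)]
    norm_num
  rw [← mul_pow, ← mul_pow, ← mul_inv, h, mul_inv_cancel₀ two_ne_zero, one_pow]

/-- the sum over the group generated by the generalized stabilizers,
`Σ_{s} W₁^{s₁} ⋯ Wₙ^{sₙ}`, equals `2^n · |ψ⟩⟨ψ|` where `ψ` is the LME state with phases
`α`: applied to any vector `φ` it gives `2^n · ⟨ψ, φ⟩ · ψ`. -/
theorem sum_of_genStab_group_eq_projection (n : ℕ) (α : (Fin n → Bool) → ℝ) :
    ∀ φ : (Fin n → Bool) → ℂ,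
      ∑ s : Fin n → Bool, genStabProd α s φ =
        ((2 : ℂ) ^ n) • hinner (lmeState α) φ • lmeState α := by
  intro φ
  funext i
  have hsum : ∑ s : Fin n → Bool, genStabProd α s φ i = Complex.exp (Complex.I * α i) *
      ∑ j, Complex.exp (-(Complex.I * α j)) * φ j := by
    simp only [genStabProd_apply, ← Finset.mul_sum]
    congr 1
    exact Equiv.sum_comp (xorBits_involutive i).toPerm
      fun j => Complex.exp (-(Complex.I * α j)) * φ j
  have hinner_eq : hinner (lmeState α) φ = (Real.sqrt 2 : ℂ)⁻¹ ^ n *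
      ∑ j, Complex.exp (-(Complex.I * α j)) * φ j := by
    simp only [hinner, conj_lmeState, mul_assoc, ← Finset.mul_sum]
  rw [Finset.sum_apply, hsum, hinner_eq]
  simp only [Pi.smul_apply, smul_eq_mul, lmeState]
  linear_combination (-(Complex.exp (Complex.I * α i) *
    ∑ j, Complex.exp (-(Complex.I * α j)) * φ j)) * two_pow_mul_inv_sqrt_two_pow n
end
end
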